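/- Let ℙ be a probability measure on Ω₊ under which (ω(x))_{x≥0} is stationary. Then for every x ≥ 0, the expected total drift ever consumed at site x satisfies E_0[D_∞^x] ≤ 1, where E_0 is the expectation with respect to the annealed measure P_0 and D_∞^x = lim_{n→∞} D_n^x. -/

import Mathlib

open MeasureTheory Filter Set Topology ProbabilityTheory
open scoped ENNReal ENat

noncomputable section

/-- A cookie environment: `ω z i` is the strength of the `(i+1)`-st cookie at site `z`
(cookies at each site are indexed by `i = 0, 1, 2, …`). -/
abbrev CEnv : Type := ℤ → ℕ → ℝ

/-- `ω` belongs to `Ω₊`, i.e. all cookie strengths lie in `[1/2, 1]`. -/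
def IsCookieEnv (ω : CEnv) : Prop := ∀ z i, ω z i ∈ Set.Icc (1/2 : ℝ) 1

/-- The number of visits of the path `x` to the site `x n` at times `m < n`. -/
def prevVisits (x : ℕ → ℤ) (n : ℕ) : ℕ :=
  ((Finset.range n).filter fun m => x m = x n).card

/-- The probability of the step from `x n` to `x (n+1)` for the multi-excited random
walk: jump to the right with the strength of the bottom remaining cookie at the current
site, to the left with the complementary probability. -/
def stepProb (ω : CEnv) (x : ℕ → ℤ) (n : ℕ) : ℝ :=
  if x (n+1) = x n + 1 then ω (x n) (prevVisits x n)
  else if x (n+1) = x n - 1 then 1 - ω (x n) (prevVisits x n)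
  else 0

/-- The probability that the walk started at `x0` follows the path `x` up to time `n`. -/
def cylProb (ω : CEnv) (x0 : ℤ) (x : ℕ → ℤ) (n : ℕ) : ℝ :=
  (if x 0 = x0 then 1 else 0) * ∏ m ∈ Finset.range n, stepProb ω x m

/-- `P` is the law `P_{x0,ω}` of the multi-excited random walk in the cookie
environment `ω` started at `x0`, characterized by its cylinder probabilities. -/
def IsERWLaw (ω : CEnv) (x0 : ℤ) (P : Measure (ℕ → ℤ)) : Prop :=
  IsProbabilityMeasure P ∧
    ∀ (x : ℕ → ℤ) (n : ℕ),
      P {Y | ∀ m ≤ n, Y m = x m} = ENNReal.ofReal (cylProb ω x0 x n)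

/-- First passage time `T_k`, with value `∞` if `k` is never visited. -/
def T (k : ℤ) (Y : ℕ → ℤ) : ℕ∞ :=
  sInf {t : ℕ∞ | ∃ n : ℕ, (n : ℕ∞) = t ∧ Y n = k}

/-- First passage time of an extended-real level, with the convention
`T_{−∞} = T_{+∞} = ∞`. -/
def Te (k : EReal) (Y : ℕ → ℤ) : ℕ∞ :=
  sInf {t : ℕ∞ | ∃ n : ℕ, (n : ℕ∞) = t ∧ ((Y n : ℝ) : EReal) = k}

/-- `R_k`, the event that the site `k` is visited infinitely often. -/
def Rset (k : ℤ) : Set (ℕ → ℤ) := {Y | ∀ N : ℕ, ∃ n ≥ N, Y n = k}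

/-- The number of visits of `Y` to the site `s` at times `< t`. -/
def visitsBefore (Y : ℕ → ℤ) (s : ℤ) (t : ℕ∞) : ℕ∞ :=
  {m : ℕ | (m : ℕ∞) < t ∧ Y m = s}.encard

/-- `D_t^s`: the total drift stored in the cookies consumed at the site `s`
before time `t` (a time in `ℕ∞`; `t = ∞` gives `D_∞^s`). -/
def driftAt (ω : CEnv) (Y : ℕ → ℤ) (s : ℤ) (t : ℕ∞) : ℝ≥0∞ :=
  ∑' i : ℕ, Set.indicator {i : ℕ | (i : ℕ∞) < visitsBefore Y s t}
    (fun i => ENNReal.ofReal (2 * ω s i - 1)) i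

/-- `D_t`: the total drift consumed before time `t` (at all sites). -/
def Dtot (ω : CEnv) (Y : ℕ → ℤ) (t : ℕ∞) : ℝ≥0∞ := ∑' s : ℤ, driftAt ω Y s t

/-- `D_t^+`: the total drift consumed at nonnegative sites before time `t`. -/
def DtotPos (ω : CEnv) (Y : ℕ → ℤ) (t : ℕ∞) : ℝ≥0∞ := ∑' s : ℕ, driftAt ω Y (s : ℤ) t

/-- `δ^s`: the total drift stored in the cookies at the site `s`. -/
def cookieDrift (ω : CEnv) (s : ℤ) : ℝ≥0∞ := ∑' i : ℕ, ENNReal.ofReal (2 * ω s i - 1)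

/-- The successive times `τ_{k,1}, τ_{k,2}, …` (indexed here from `0`) at which the
walk is at a site `≥ k`. -/
def tauT (k : ℤ) (Y : ℕ → ℤ) : ℕ → ℕ∞
  | 0 => sInf {t : ℕ∞ | ∃ n : ℕ, (n : ℕ∞) = t ∧ k ≤ Y n}
  | m + 1 => sInf {t : ℕ∞ | ∃ n : ℕ, (n : ℕ∞) = t ∧ tauT k Y m < (n : ℕ∞) ∧ k ≤ Y n}

/-- The observed sequence `(X_{τ_{k,m}})_{m ≥ 1}` (indexed here from `0`). -/
def obsSeq (k : ℤ) (Y : ℕ → ℤ) (m : ℕ) : ℤ := Y (tauT k Y m).toNat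

/-- The one-sided shift on sequences. -/
def shiftSeq {α : Type*} (u : ℕ → α) : ℕ → α := fun n => u (n + 1)

/-- The restriction `(ω(x))_{x ≥ 0}` of an environment to the nonnegative sites. -/
def restrictNN (ω : CEnv) : ℕ → ℕ → ℝ := fun x => ω (x : ℤ)

/-- `(ω(x))_{x ≥ 0}` is stationary under `Pr`: its law is invariant under the shift. -/
def IsStationaryEnv (Pr : Measure CEnv) : Prop :=
  MeasurePreserving shiftSeq (Pr.map restrictNN) (Pr.map restrictNN)

/-- `(ω(x))_{x ≥ 0}` is stationary and ergodic under `Pr`. -/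
def IsStatErgEnv (Pr : Measure CEnv) : Prop :=
  Ergodic shiftSeq (Pr.map restrictNN)

/-- The process `ξ_k = ((ω(x+k))_{x≥0}, (X_{τ_{k,m}} − k)_{m≥0})` consisting of the
environment to the right of `k` and the trajectory at sites `≥ k`, recentered at `k`. -/
def xiProc (p : CEnv × (ℕ → ℤ)) (k : ℕ) : (ℕ → ℕ → ℝ) × (ℕ → ℤ) :=
  (fun x : ℕ => p.1 ((x : ℤ) + (k : ℤ)), fun m => obsSeq (k : ℤ) p.2 m - (k : ℤ))

/-- The environment left over after the bottom cookie at the site `y` has been eaten. -/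
def eatCookie (y : ℤ) (ω : CEnv) : CEnv := fun z i => if z = y then ω z (i + 1) else ω z i

/-- The drift of the bottom cookie at `y`, counted only if `y` is the observed site `s`. -/
def bottomDrift (s y : ℤ) (ω : CEnv) : ℝ≥0∞ :=
  if y = s then ENNReal.ofReal (2 * ω y 0 - 1) else 0

/-- The expected drift consumed at the site `s` during the first `n` steps of the walk started
at `y` in the environment `ω` and stopped upon reaching the level `k`. -/
def stoppedDrift (s k : ℤ) : ℕ → ℤ → CEnv → ℝ≥0∞
  | 0, _, _ => 0
  | n + 1, y, ω =>
    if k ≤ y then 0 else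
      bottomDrift s y ω
        + (ENNReal.ofReal (ω y 0) * stoppedDrift s k n (y + 1) (eatCookie y ω)
          + ENNReal.ofReal (1 - ω y 0) * stoppedDrift s k n (y - 1) (eatCookie y ω))

/-- The expected drift consumed at the site `s` before the walk started at `y` in the
environment `ω` reaches the level `k`. -/
def hitDrift (s k y : ℤ) (ω : CEnv) : ℝ≥0∞ := ⨆ n, stoppedDrift s k n y ω

lemma IsCookieEnv.eatCookie {ω : CEnv} (h : IsCookieEnv ω) (y : ℤ) :
    IsCookieEnv (eatCookie y ω) := by
  intro z i
  unfold _root_.eatCookie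
  split_ifs <;> exact h _ _

lemma stoppedDrift_of_le {s k y : ℤ} (h : k ≤ y) (n : ℕ) (ω : CEnv) :
    stoppedDrift s k n y ω = 0 := by
  cases n <;> simp [stoppedDrift, h]

lemma stoppedDrift_succ {s k y : ℤ} (h : y < k) (n : ℕ) (ω : CEnv) :
    stoppedDrift s k (n + 1) y ω = bottomDrift s y ω
        + (ENNReal.ofReal (ω y 0) * stoppedDrift s k n (y + 1) (eatCookie y ω)
          + ENNReal.ofReal (1 - ω y 0) * stoppedDrift s k n (y - 1) (eatCookie y ω)) := by
  simp [stoppedDrift, h]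

lemma stoppedDrift_le_succ (s k : ℤ) (n : ℕ) (y : ℤ) (ω : CEnv) :
    stoppedDrift s k n y ω ≤ stoppedDrift s k (n + 1) y ω := by
  induction n generalizing y ω with
  | zero => simp [stoppedDrift]
  | succ n ih =>
    rcases le_or_gt k y with h | h
    · simp [stoppedDrift_of_le h]
    · rw [stoppedDrift_succ h, stoppedDrift_succ h]
      gcongr <;> exact ih _ _

lemma monotone_stoppedDrift (s k y : ℤ) (ω : CEnv) :
    Monotone fun n => stoppedDrift s k n y ω :=
  monotone_nat_of_le_succ fun n => stoppedDrift_le_succ s k n y ω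

lemma stoppedDrift_le_hitDrift (s k : ℤ) (n : ℕ) (y : ℤ) (ω : CEnv) :
    stoppedDrift s k n y ω ≤ hitDrift s k y ω :=
  le_iSup (fun n => stoppedDrift s k n y ω) n

lemma stoppedDrift_mono_level {s k k' : ℤ} (hk : k ≤ k') (n : ℕ) (y : ℤ) (ω : CEnv) :
    stoppedDrift s k n y ω ≤ stoppedDrift s k' n y ω := by
  induction n generalizing y ω with
  | zero => simp [stoppedDrift]
  | succ n ih =>
    rcases le_or_gt k y with h | h
    · simp [stoppedDrift_of_le h]
    · rw [stoppedDrift_succ h, stoppedDrift_succ (h.trans_le hk)]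
      gcongr <;> exact ih _ _

lemma hitDrift_mono_level {s k k' : ℤ} (hk : k ≤ k') (y : ℤ) (ω : CEnv) :
    hitDrift s k y ω ≤ hitDrift s k' y ω :=
  iSup_mono fun n => stoppedDrift_mono_level hk n y ω

lemma hitDrift_step_le {s k y : ℤ} (h : y < k) (ω : CEnv) :
    bottomDrift s y ω
        + (ENNReal.ofReal (ω y 0) * hitDrift s k (y + 1) (eatCookie y ω)
          + ENNReal.ofReal (1 - ω y 0) * hitDrift s k (y - 1) (eatCookie y ω))
      ≤ hitDrift s k y ω := by
  unfold hitDrift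
  rw [ENNReal.mul_iSup, ENNReal.mul_iSup, ENNReal.iSup_add_iSup_of_monotone, ENNReal.add_iSup]
  · refine iSup_le fun n => ?_
    rw [← stoppedDrift_succ h]
    exact stoppedDrift_le_hitDrift s k (n + 1) y ω
  · exact fun a b hab => by gcongr; exact monotone_stoppedDrift _ _ _ _ hab
  · exact fun a b hab => by gcongr; exact monotone_stoppedDrift _ _ _ _ hab

lemma ofReal_mul_add_ofReal_one_sub_mul {w : ℝ} (hw : w ∈ Set.Icc (1 / 2 : ℝ) 1) (C : ℝ≥0∞) :
    ENNReal.ofReal w * C + ENNReal.ofReal (1 - w) * C = C := by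
  rw [← add_mul, ← ENNReal.ofReal_add (by linarith [hw.1]) (by linarith [hw.2])]
  simp

/-- The probability that simple symmetric random walk started at `j` hits `0` within `m` steps. -/
def srwHit : ℕ → ℕ → ℝ
  | _, 0 => 1
  | 0, _ + 1 => 0
  | m + 1, j + 1 => (srwHit m j + srwHit m (j + 2)) / 2

lemma srwHit_zero (m : ℕ) : srwHit m 0 = 1 := by cases m <;> rfl

lemma srwHit_nonneg (m j : ℕ) : 0 ≤ srwHit m j := by
  induction m generalizing j with
  | zero => cases j <;> simp [srwHit]
  | succ m ih =>
    cases j with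
    | zero => simp [srwHit]
    | succ j => simp only [srwHit]; linarith [ih j, ih (j + 2)]

lemma srwHit_le_one (m j : ℕ) : srwHit m j ≤ 1 := by
  induction m generalizing j with
  | zero => cases j <;> simp [srwHit]
  | succ m ih =>
    cases j with
    | zero => simp [srwHit]
    | succ j => simp only [srwHit]; linarith [ih j, ih (j + 2)]

lemma srwHit_succ_right_le (m j : ℕ) : srwHit m (j + 1) ≤ srwHit m j := by
  induction m generalizing j with
  | zero => cases j <;> simp [srwHit]
  | succ m ih =>
    cases j with
    | zero => exact (srwHit_le_one _ _).trans_eq (srwHit_zero _).symm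
    | succ j => simp only [srwHit]; linarith [ih j, ih (j + 2)]

lemma srwHit_le_succ_left (m j : ℕ) : srwHit m j ≤ srwHit (m + 1) j := by
  induction m generalizing j with
  | zero =>
    cases j with
    | zero => simp [srwHit]
    | succ j => exact srwHit_nonneg _ _
  | succ m ih =>
    cases j with
    | zero => simp [srwHit]
    | succ j => rw [srwHit, srwHit]; linarith [ih j, ih (j + 2)]

/-- Simple symmetric random walk is recurrent. -/
lemma tendsto_srwHit (j : ℕ) : Tendsto (fun m => srwHit m j) atTop (𝓝 1) := by
  have hconv (j : ℕ) : ∃ q, Tendsto (fun m => srwHit m j) atTop (𝓝 q) :=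
    ⟨_, tendsto_atTop_ciSup (monotone_nat_of_le_succ fun m => srwHit_le_succ_left m j)
      ⟨1, by rintro _ ⟨m, rfl⟩; exact srwHit_le_one m j⟩⟩
  choose q hq using hconv
  have hq0 : q 0 = 1 := by
    refine tendsto_nhds_unique (hq 0) ?_
    simp [srwHit_zero]
  have hstep (j : ℕ) : q (j + 1) = (q j + q (j + 2)) / 2 :=
    tendsto_nhds_unique ((tendsto_add_atTop_iff_nat 1).2 (hq (j + 1)))
      (((hq j).add (hq (j + 2))).div_const 2)
  have hnn (j : ℕ) : 0 ≤ q j := ge_of_tendsto' (hq j) fun m => srwHit_nonneg m j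
  have hle : q 1 ≤ 1 := le_of_tendsto' (hq 1) fun m => srwHit_le_one m 1
  have haff (j : ℕ) : q j = 1 - j * (1 - q 1) ∧ q (j + 1) = 1 - (j + 1) * (1 - q 1) := by
    induction j with
    | zero => simp [hq0]
    | succ j ih =>
      refine ⟨by rw [ih.2]; push_cast; ring, ?_⟩
      have := hstep j
      push_cast
      linarith [ih.1, ih.2]
  have hq1 : q 1 = 1 := by
    by_contra hne
    obtain ⟨n, hn⟩ := exists_nat_gt (1 / (1 - q 1))
    have hpos : 0 < 1 - q 1 := sub_pos.2 (lt_of_le_of_ne hle hne)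
    rw [div_lt_iff₀ hpos] at hn
    linarith [(haff n).1, hnn n]
  have := hq j
  rwa [(haff j).1, hq1, sub_self, mul_zero, sub_zero] at this

/-- The walk reaches `s` from any site to its left, so a lower bound for `hitDrift` at `s` that
does not depend on the cookies to the left of `s` propagates to the left of `s`. -/
lemma le_hitDrift_left {s k : ℤ} (hsk : s < k) {ω : CEnv} {C : ℝ≥0∞}
    (hC : ∀ ω', IsCookieEnv ω' → (∀ z, s ≤ z → ω' z = ω z) → C ≤ hitDrift s k s ω')
    {y : ℤ} (hy : y ≤ s) {ω' : CEnv} (hω' : IsCookieEnv ω') (heq : ∀ z, s ≤ z → ω' z = ω z) :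
    C ≤ hitDrift s k y ω' := by
  have key (m j : ℕ) (ω' : CEnv) (hω' : IsCookieEnv ω') (heq : ∀ z, s ≤ z → ω' z = ω z) :
      C * ENNReal.ofReal (srwHit m j) ≤ hitDrift s k (s - j) ω' := by
    induction m generalizing j ω' with
    | zero =>
      cases j with
      | zero => simpa [srwHit] using hC ω' hω' heq
      | succ j => simp [srwHit]
    | succ m ih =>
      cases j with
      | zero => simpa [srwHit] using hC ω' hω' heq
      | succ j =>
        have heat : ∀ z, s ≤ z → eatCookie (s - (j + 1 : ℕ)) ω' z = ω z := by
          intro z hz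
          have hne : z ≠ s - (j + 1 : ℕ) := by push_cast; omega
          rw [← heq z hz]
          ext i
          rw [eatCookie, if_neg hne]
        have h1 := ih j _ (hω'.eatCookie _) heat
        have h2 := ih (j + 2) _ (hω'.eatCookie _) heat
        have hlt : s - (j + 1 : ℕ) < k := by push_cast; omega
        refine le_trans ?_ (hitDrift_step_le hlt ω')
        rw [show s - ((j + 1 : ℕ) : ℤ) + 1 = s - j by push_cast; ring,
          show s - ((j + 1 : ℕ) : ℤ) - 1 = s - (j + 2 : ℕ) by push_cast; ring]
        refine le_trans ?_ (le_add_self.trans' (add_le_add (mul_le_mul_right h1 _)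
          (mul_le_mul_right h2 _)))
        obtain ⟨hw1, hw2⟩ := hω' (s - (j + 1 : ℕ)) 0
        set w := ω' (s - (j + 1 : ℕ)) 0
        rw [mul_left_comm, mul_left_comm (ENNReal.ofReal (1 - w)), ← mul_add,
          ← ENNReal.ofReal_mul (by linarith), ← ENNReal.ofReal_mul (by linarith),
          ← ENNReal.ofReal_add (mul_nonneg (by linarith) (srwHit_nonneg _ _))
            (mul_nonneg (by linarith) (srwHit_nonneg _ _))]
        gcongr
        rw [srwHit]
        nlinarith [srwHit_succ_right_le m j, srwHit_succ_right_le m (j + 1)]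
  obtain ⟨j, hj⟩ := Int.eq_ofNat_of_zero_le (sub_nonneg.2 hy)
  obtain rfl : y = s - j := by omega
  have hlim : Tendsto (fun m => C * ENNReal.ofReal (srwHit m j)) atTop (𝓝 (C * 1)) := by
    refine ENNReal.Tendsto.const_mul ?_ (Or.inl one_ne_zero)
    simpa using ENNReal.tendsto_ofReal (tendsto_srwHit j)
  rw [mul_one] at hlim
  exact le_of_tendsto' hlim fun m => key m j ω' hω' heq

/-- The drift consumed at `s` does not depend on the cookies to the left of `s`, nor on the
starting point as long as it is not to the right of `s`. -/
lemma stoppedDrift_le_hitDrift_of_eq {s k : ℤ} (hsk : s < k) (n : ℕ) {ω ω' : CEnv}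
    (hω : IsCookieEnv ω) (hω' : IsCookieEnv ω') (heq : ∀ z, s ≤ z → ω z = ω' z) {y y' : ℤ}
    (hy : y = y' ∨ (y ≤ s ∧ y' ≤ s)) :
    stoppedDrift s k n y ω ≤ hitDrift s k y' ω' := by
  induction n generalizing ω ω' y y' with
  | zero => simp [stoppedDrift]
  | succ n ih =>
    have hright (y : ℤ) (hsy : s ≤ y) (ω' : CEnv) (hω' : IsCookieEnv ω')
        (heq : ∀ z, s ≤ z → ω z = ω' z) :
        stoppedDrift s k (n + 1) y ω ≤ hitDrift s k y ω' := by
      rcases le_or_gt k y with h | h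
      · simp [stoppedDrift_of_le h]
      rw [stoppedDrift_succ h]
      refine le_trans ?_ (hitDrift_step_le h ω')
      have heat : ∀ z, s ≤ z → eatCookie y ω z = eatCookie y ω' z := by
        intro z hz
        ext i
        simp only [eatCookie, heq z hz]
      rw [bottomDrift, bottomDrift, heq y hsy]
      gcongr
      · exact ih (hω.eatCookie y) (hω'.eatCookie y) heat (Or.inl rfl)
      · exact ih (hω.eatCookie y) (hω'.eatCookie y) heat (Or.inl rfl)
    by_cases hboth : y ≤ s ∧ y' ≤ s
    · refine le_hitDrift_left hsk (ω := ω) ?_ hboth.2 hω' (fun z hz => (heq z hz).symm)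
      intro ω'' hω'' heq''
      rcases hboth.1.eq_or_lt with rfl | hlt
      · exact hright y le_rfl ω'' hω'' fun z hz => (heq'' z hz).symm
      · have heat : ∀ z, s ≤ z → eatCookie y ω z = ω'' z := by
          intro z hz
          have hne : z ≠ y := by omega
          rw [heq'' z hz]
          ext i
          rw [eatCookie, if_neg hne]
        rw [stoppedDrift_succ (hlt.trans hsk), bottomDrift, if_neg hlt.ne, zero_add]
        refine le_trans ?_ (ofReal_mul_add_ofReal_one_sub_mul (hω y 0) _).le
        gcongr
        · exact ih (hω.eatCookie y) hω'' heat (Or.inr ⟨by omega, le_rfl⟩)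
        · exact ih (hω.eatCookie y) hω'' heat (Or.inr ⟨by omega, le_rfl⟩)
    · obtain rfl : y = y' := by tauto
      exact hright y (by omega) ω' hω' heq

lemma hitDrift_eq_of_eq {s k : ℤ} (hsk : s < k) {ω ω' : CEnv}
    (hω : IsCookieEnv ω) (hω' : IsCookieEnv ω') (heq : ∀ z, s ≤ z → ω z = ω' z) {y y' : ℤ}
    (hy : y ≤ s) (hy' : y' ≤ s) :
    hitDrift s k y ω = hitDrift s k y' ω' :=
  le_antisymm
    (iSup_le fun n => stoppedDrift_le_hitDrift_of_eq hsk n hω hω' heq (Or.inr ⟨hy, hy'⟩))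
    (iSup_le fun n => stoppedDrift_le_hitDrift_of_eq hsk n hω' hω
      (fun z hz => (heq z hz).symm) (Or.inr ⟨hy', hy⟩))

/-- The position minus the drift consumed so far is a martingale, so the total drift consumed
at finitely many sites before reaching the level `k` is at most the distance to `k`. -/
lemma sum_stoppedDrift_le (S : Finset ℤ) (k : ℤ) (n : ℕ) {y : ℤ} (hy : y ≤ k) {ω : CEnv}
    (hω : IsCookieEnv ω) :
    ∑ s ∈ S, stoppedDrift s k n y ω ≤ ENNReal.ofReal ((k - y : ℤ) : ℝ) := by
  induction n generalizing y ω with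
  | zero => simp [stoppedDrift]
  | succ n ih =>
    rcases hy.eq_or_lt with rfl | hlt
    · simp [stoppedDrift_of_le le_rfl]
    have h1 := ih (y := y + 1) (by omega) (hω.eatCookie y)
    have h2 := ih (y := y - 1) (by omega) (hω.eatCookie y)
    obtain ⟨hw1, hw2⟩ := hω y 0
    have h0 : ∑ s ∈ S, bottomDrift s y ω ≤ ENNReal.ofReal (2 * ω y 0 - 1) := by
      simp only [bottomDrift, Finset.sum_ite_eq]
      split_ifs <;> simp
    have hky : (y : ℝ) + 1 ≤ k := by exact_mod_cast hlt
    simp only [stoppedDrift_succ hlt, Finset.sum_add_distrib, ← Finset.mul_sum]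
    refine (add_le_add h0 (add_le_add (mul_le_mul_right h1 _) (mul_le_mul_right h2 _))).trans ?_
    push_cast
    rw [← ENNReal.ofReal_mul (by linarith), ← ENNReal.ofReal_mul (by linarith),
      ← ENNReal.ofReal_add (mul_nonneg (by linarith) (by linarith))
        (mul_nonneg (by linarith) (by linarith)),
      ← ENNReal.ofReal_add (by linarith) (add_nonneg (mul_nonneg (by linarith) (by linarith))
        (mul_nonneg (by linarith) (by linarith)))]
    apply ENNReal.ofReal_le_ofReal
    nlinarith

lemma sum_hitDrift_le (S : Finset ℤ) {k y : ℤ} (hy : y ≤ k) {ω : CEnv} (hω : IsCookieEnv ω) :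
    ∑ s ∈ S, hitDrift s k y ω ≤ ENNReal.ofReal ((k - y : ℤ) : ℝ) := by
  unfold hitDrift
  rw [ENNReal.finsetSum_iSup_of_monotone fun s => monotone_stoppedDrift s k y ω]
  exact iSup_le fun n => sum_stoppedDrift_le S k n hy hω

lemma stoppedDrift_translate (a s k : ℤ) (n : ℕ) (y : ℤ) (ω : CEnv) :
    stoppedDrift s k n y (fun z => ω (z + a)) = stoppedDrift (s + a) (k + a) n (y + a) ω := by
  induction n generalizing y ω with
  | zero => rfl
  | succ n ih =>
    have heat : eatCookie y (fun z => ω (z + a)) = fun z => eatCookie (y + a) ω (z + a) := by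
      ext z i
      simp [eatCookie]
    simp only [stoppedDrift, heat, ih, bottomDrift, add_le_add_iff_right, add_left_inj]
    rw [show y + 1 + a = y + a + 1 by ring, show y - 1 + a = y + a - 1 by ring]

lemma hitDrift_translate (a s k y : ℤ) (ω : CEnv) :
    hitDrift s k y (fun z => ω (z + a)) = hitDrift (s + a) (k + a) (y + a) ω := by
  simp only [hitDrift, stoppedDrift_translate]

@[fun_prop]
lemma measurable_eatCookie (y : ℤ) : Measurable (eatCookie y) := by
  refine measurable_pi_lambda _ fun z => measurable_pi_lambda _ fun i => ?_
  unfold eatCookie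
  split_ifs <;> fun_prop

lemma measurable_stoppedDrift (s k : ℤ) (n : ℕ) (y : ℤ) : Measurable (stoppedDrift s k n y) := by
  induction n generalizing y with
  | zero => exact measurable_const
  | succ n ih =>
    rcases le_or_gt k y with h | h
    · simp only [funext (stoppedDrift_of_le h _), measurable_const]
    · simp only [funext (stoppedDrift_succ h n), bottomDrift]
      have h1 := (ih (y + 1)).comp (measurable_eatCookie y)
      have h2 := (ih (y - 1)).comp (measurable_eatCookie y)
      simp only [Function.comp_def] at h1 h2
      split_ifs <;> fun_prop

lemma measurable_hitDrift (s k y : ℤ) : Measurable (hitDrift s k y) :=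
  Measurable.iSup fun n => measurable_stoppedDrift s k n y

/-- The drift of the cookie consumed at time `n`, counted only if it is consumed at `s`. -/
def driftStep (s : ℤ) (ω : CEnv) (Y : ℕ → ℤ) (n : ℕ) : ℝ≥0∞ :=
  if Y n = s then ENNReal.ofReal (2 * ω s (prevVisits Y n) - 1) else 0

lemma driftAt_top_le (s : ℤ) (ω : CEnv) (Y : ℕ → ℤ) :
    driftAt ω Y s ⊤ ≤ ⨆ N, ∑ n ∈ Finset.range N, driftStep s ω Y n := by
  rw [← ENNReal.tsum_eq_iSup_nat, driftAt, ← tsum_subtype]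
  set p : ℕ → Prop := fun m => Y m = s with hp
  have hv : visitsBefore Y s ⊤ = (Set.ofPred p).encard := by
    simp [visitsBefore, hp]
  have hlt (i : {i : ℕ | (i : ℕ∞) < visitsBefore Y s ⊤}) :
      ∀ hf : (Set.ofPred p).Finite, i.1 < hf.toFinset.card := by
    intro hf
    have : (i.1 : ℕ∞) < (Set.ofPred p).encard := hv ▸ i.property.out
    rw [hf.encard_eq_coe_toFinset_card] at this
    exact_mod_cast this
  have hinj : Function.Injective
      fun i : {i : ℕ | (i : ℕ∞) < visitsBefore Y s ⊤} => Nat.nth p i := by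
    intro i j hij
    have := congrArg (Nat.count p) hij
    simp only [Nat.count_nth (hlt i), Nat.count_nth (hlt j)] at this
    exact Subtype.ext this
  refine le_trans (le_of_eq ?_) (ENNReal.tsum_comp_le_tsum_of_injective hinj _)
  refine tsum_congr fun i => ?_
  have hm : Y (Nat.nth p i) = s := Nat.nth_mem (p := p) i (hlt i)
  have hprev : prevVisits Y (Nat.nth p i) = i := by
    rw [prevVisits, hm, ← Nat.count_eq_card_filter_range]
    exact Nat.count_nth (hlt i)
  rw [driftStep, if_pos hm, hprev]

@[fun_prop]
lemma measurable_prevVisits (n : ℕ) : Measurable fun Y : ℕ → ℤ => prevVisits Y n := by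
  simp only [prevVisits, Finset.card_filter]
  refine Finset.measurable_sum _ fun m _ => Measurable.ite ?_ measurable_const measurable_const
  exact measurableSet_eq_fun (by fun_prop) (by fun_prop)

lemma measurable_driftStep (s : ℤ) (n : ℕ) :
    Measurable fun p : CEnv × (ℕ → ℤ) => driftStep s p.1 p.2 n := by
  have h : Measurable fun q : CEnv × ℕ => q.1 s q.2 :=
    measurable_from_prod_countable_left fun i => by dsimp only; fun_prop
  have h' : Measurable fun p : CEnv × (ℕ → ℤ) => p.1 s (prevVisits p.2 n) :=
    h.comp (measurable_fst.prodMk ((measurable_prevVisits n).comp measurable_snd))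
  refine Measurable.ite ?_ (by fun_prop) measurable_const
  exact measurableSet_eq_fun (by fun_prop) measurable_const

lemma prevVisits_succ (Y : ℕ → ℤ) (n : ℕ) :
    prevVisits Y (n + 1)
      = prevVisits (shiftSeq Y) n + if Y 0 = Y (n + 1) then 1 else 0 := by
  rw [prevVisits, prevVisits, Finset.card_filter, Finset.card_filter, Finset.sum_range_succ']
  rfl

lemma eatCookie_prevVisits (ω : CEnv) (Y : ℕ → ℤ) (n : ℕ) :
    eatCookie (Y 0) ω (shiftSeq Y n) (prevVisits (shiftSeq Y) n)
      = ω (Y (n + 1)) (prevVisits Y (n + 1)) := by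
  rw [prevVisits_succ, eatCookie, shiftSeq]
  split_ifs with h h' h'
  · rfl
  · exact absurd h.symm h'
  · exact absurd h'.symm h
  · rfl

lemma driftStep_succ (s : ℤ) (ω : CEnv) (Y : ℕ → ℤ) (n : ℕ) :
    driftStep s ω Y (n + 1) = driftStep s (eatCookie (Y 0) ω) (shiftSeq Y) n := by
  unfold driftStep
  by_cases h : Y (n + 1) = s
  · have h' : shiftSeq Y n = s := h
    have := eatCookie_prevVisits ω Y n
    rw [h, h'] at this
    rw [if_pos h, if_pos h', this]
  · have h' : shiftSeq Y n ≠ s := h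
    rw [if_neg h, if_neg h']

lemma stepProb_succ (ω : CEnv) (Y : ℕ → ℤ) (n : ℕ) :
    stepProb ω Y (n + 1) = stepProb (eatCookie (Y 0) ω) (shiftSeq Y) n := by
  rw [stepProb, stepProb, eatCookie_prevVisits]
  rfl

lemma cylProb_succ (ω : CEnv) (Y : ℕ → ℤ) (n : ℕ) :
    cylProb ω (Y 0) Y (n + 1)
      = stepProb ω Y 0 * cylProb (eatCookie (Y 0) ω) (Y 1) (shiftSeq Y) n := by
  simp [cylProb, Finset.prod_range_succ', stepProb_succ, shiftSeq, mul_comm]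

/-- `P` is `c` times the law of the multi-excited random walk in the environment `ω` started
at `y`, characterized by its cylinder probabilities. -/
def IsScaledERWLaw (c : ℝ≥0∞) (ω : CEnv) (y : ℤ) (P : Measure (ℕ → ℤ)) : Prop :=
  ∀ (x : ℕ → ℤ) (n : ℕ),
    P {Y | ∀ m ≤ n, Y m = x m} = c * ENNReal.ofReal (cylProb ω y x n)

@[fun_prop]
lemma measurable_shiftSeq {α : Type*} [MeasurableSpace α] :
    Measurable (shiftSeq : (ℕ → α) → ℕ → α) :=
  measurable_pi_lambda _ fun n => measurable_pi_apply (n + 1)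

namespace IsScaledERWLaw

variable {c : ℝ≥0∞} {ω : CEnv} {y : ℤ} {P : Measure (ℕ → ℤ)}

lemma ae_zero_one (h : IsScaledERWLaw c ω y P) :
    ∀ᵐ Y ∂P, Y 0 = y ∧ (Y 1 = y + 1 ∨ Y 1 = y - 1) := by
  have hbad : ∀ᵐ Y ∂P, ∀ a b : ℤ, ¬ (a = y ∧ (b = y + 1 ∨ b = y - 1)) →
      ¬ (Y 0 = a ∧ Y 1 = b) := by
    simp only [ae_all_iff]
    intro a b hab
    have := h (fun m => if m = 0 then a else b) 1
    have hz : cylProb ω y (fun m => if m = 0 then a else b) 1 = 0 := by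
      by_cases ha : a = y
      · subst ha
        simp only [true_and, not_or] at hab
        simp [cylProb, stepProb, hab.1, hab.2]
      · simp [cylProb, ha]
    rw [hz, ENNReal.ofReal_zero, mul_zero] at this
    rw [ae_iff]
    refine measure_mono_null (fun Y hY => ?_) this
    simp only [not_not, Set.mem_ofPred_eq] at hY ⊢
    intro m hm
    interval_cases m
    · simpa using hY.1
    · simpa using hY.2
  filter_upwards [hbad] with Y hY
  by_contra hcon
  exact hY _ _ hcon ⟨rfl, rfl⟩

lemma measure_univ_eq (h : IsScaledERWLaw c ω y P) : P Set.univ = c := by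
  have h0 : P {Y | ∀ m ≤ 0, Y m = y} = c := by
    rw [h (fun _ => y) 0]
    simp [cylProb]
  rw [← h0]
  refine measure_congr ?_
  filter_upwards [h.ae_zero_one] with Y hY
  refine (eq_true (Set.mem_univ Y)).trans (eq_true ?_).symm
  rintro m hm
  rw [Nat.le_zero.1 hm, hY.1]

/-- The Markov property at time `1`. -/
lemma map_shiftSeq (h : IsScaledERWLaw c ω y P) {z : ℤ} {w : ℝ}
    (hw : ∀ Y : ℕ → ℤ, Y 0 = y → Y 1 = z → stepProb ω Y 0 = w) (hw0 : 0 ≤ w) :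
    IsScaledERWLaw (c * ENNReal.ofReal w) (eatCookie y ω) z
      ((P.restrict {Y | Y 0 = y ∧ Y 1 = z}).map shiftSeq) := by
  intro x n
  have hmeas : MeasurableSet {Y : ℕ → ℤ | ∀ m ≤ n, Y m = x m} := by
    simp only [Set.ofPred_forall]
    exact MeasurableSet.iInter fun m => MeasurableSet.iInter fun _ =>
      measurableSet_eq_fun (by fun_prop) measurable_const
  rw [Measure.map_apply measurable_shiftSeq hmeas,
    Measure.restrict_apply (measurable_shiftSeq hmeas)]
  by_cases hx : x 0 = z
  · set x' : ℕ → ℤ := fun m => Nat.casesOn m y x with hx'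
    have hset : shiftSeq ⁻¹' {Y : ℕ → ℤ | ∀ m ≤ n, Y m = x m} ∩ {Y | Y 0 = y ∧ Y 1 = z}
        = {Y | ∀ m ≤ n + 1, Y m = x' m} := by
      ext Y
      simp only [Set.mem_inter_iff, Set.mem_preimage, Set.mem_ofPred_eq, shiftSeq]
      constructor
      · rintro ⟨h1, h2, -⟩ m hm
        cases m with
        | zero => exact h2
        | succ m => exact h1 m (by omega)
      · intro hY
        exact ⟨fun m hm => hY (m + 1) (by omega), hY 0 (by omega),
          (hY 1 (by omega)).trans hx⟩
    have hcyl := cylProb_succ ω x' n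
    rw [hw x' rfl hx] at hcyl
    have h1 : x' 1 = z := hx
    rw [h1] at hcyl
    rw [hset, h x' (n + 1), mul_assoc, ← ENNReal.ofReal_mul hw0]
    exact congrArg (fun t => c * ENNReal.ofReal t) hcyl
  · have hset : shiftSeq ⁻¹' {Y : ℕ → ℤ | ∀ m ≤ n, Y m = x m} ∩ {Y | Y 0 = y ∧ Y 1 = z}
        = ∅ := by
      ext Y
      simp only [Set.mem_inter_iff, Set.mem_preimage, Set.mem_ofPred_eq, shiftSeq,
        Set.mem_empty_iff_false, iff_false, not_and]
      intro h1 _ h2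
      exact hx ((h1 0 (by omega)).symm.trans h2)
    rw [hset]
    simp [cylProb, hx]

lemma lintegral_driftStep_le (h : IsScaledERWLaw c ω y P) (hω : IsCookieEnv ω) (s : ℤ) {k : ℤ}
    {N : ℕ} (hN : y + N ≤ k) :
    ∫⁻ Y, ∑ n ∈ Finset.range N, driftStep s ω Y n ∂P ≤ c * stoppedDrift s k N y ω := by
  induction N generalizing c ω y P with
  | zero => simp
  | succ N ih =>
    push_cast at hN
    have hm (ω : CEnv) :
        Measurable fun Y : ℕ → ℤ => ∑ n ∈ Finset.range N, driftStep s ω Y n :=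
      Finset.measurable_sum _ fun n _ => (measurable_driftStep s n).comp measurable_prodMk_left
    have hright := (h.map_shiftSeq (z := y + 1) (w := ω y 0)
      (by intro Y h0 h1; simp [stepProb, h0, h1, prevVisits])
      (by linarith [(hω y 0).1]))
    have hleft := (h.map_shiftSeq (z := y - 1) (w := 1 - ω y 0)
      (by intro Y h0 h1
          have : y - 1 ≠ y + 1 := by omega
          simp [stepProb, h0, h1, prevVisits, this])
      (by linarith [(hω y 0).2]))
    have hright' := ih hright (hω.eatCookie y) (by omega)
    have hleft' := ih hleft (hω.eatCookie y) (by omega)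
    rw [lintegral_map (hm _) measurable_shiftSeq] at hright' hleft'
    have hae : ∀ᵐ Y ∂P, ∑ n ∈ Finset.range (N + 1), driftStep s ω Y n
        = bottomDrift s y ω + ∑ n ∈ Finset.range N,
            driftStep s (eatCookie y ω) (shiftSeq Y) n := by
      filter_upwards [h.ae_zero_one] with Y hY
      rw [Finset.sum_range_succ', add_comm]
      congr 1
      · rw [driftStep, bottomDrift, hY.1]
        split_ifs with hys
        · simp [prevVisits, hys]
        · rfl
      · simp only [driftStep_succ, hY.1]
    have hunion : P.restrict ({Y | Y 0 = y ∧ Y 1 = y + 1} ∪ {Y | Y 0 = y ∧ Y 1 = y - 1}) = P := by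
      refine Measure.restrict_eq_self_of_ae_mem ?_
      filter_upwards [h.ae_zero_one] with Y hY
      exact hY.2.imp (fun h1 => ⟨hY.1, h1⟩) fun h1 => ⟨hY.1, h1⟩
    rw [lintegral_congr_ae hae, lintegral_add_left measurable_const, lintegral_const,
      h.measure_univ_eq, stoppedDrift_succ (by omega), mul_add, mul_comm c]
    gcongr
    rw [← hunion]
    refine (lintegral_union_le _ _ _).trans ?_
    rw [mul_add, ← mul_assoc, ← mul_assoc]
    exact add_le_add hright' hleft'

end IsScaledERWLaw

lemma IsERWLaw.isScaledERWLaw {ω : CEnv} {y : ℤ} {P : Measure (ℕ → ℤ)} (h : IsERWLaw ω y P) :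
    IsScaledERWLaw 1 ω y P := fun x n => by rw [h.2 x n, one_mul]

/-- The environment that equals `u` at the nonnegative sites and `u 0` at the negative ones. -/
def extendEnv (u : ℕ → ℕ → ℝ) : CEnv := fun z => u z.toNat

@[fun_prop]
lemma measurable_extendEnv : Measurable extendEnv :=
  measurable_pi_lambda _ fun z => measurable_pi_apply z.toNat

@[fun_prop]
lemma measurable_restrictNN : Measurable restrictNN :=
  measurable_pi_lambda _ fun x => measurable_pi_apply (x : ℤ)

lemma iterate_shiftSeq {α : Type*} (u : ℕ → α) (a n : ℕ) : shiftSeq^[a] u n = u (n + a) := by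
  induction a generalizing u with
  | zero => rfl
  | succ a ih => rw [Function.iterate_succ_apply, ih, shiftSeq, add_assoc]

/-- By stationarity, the expected drift consumed at `a` depends only on the distance from `a`
to the level at which the walk is stopped. -/
lemma lintegral_hitDrift_eq {Pr : Measure CEnv} (hcookie : ∀ᵐ ω ∂Pr, IsCookieEnv ω)
    (hstat : IsStationaryEnv Pr) (a : ℕ) {k : ℤ} (hk : 0 < k) :
    ∫⁻ ω, hitDrift a (k + a) 0 ω ∂Pr
      = ∫⁻ u, hitDrift 0 k 0 (extendEnv u) ∂(Pr.map restrictNN) := by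
  have hG : Measurable fun u => hitDrift 0 k 0 (extendEnv u) :=
    (measurable_hitDrift 0 k 0).comp measurable_extendEnv
  have hiter := MeasurePreserving.iterate hstat a
  rw [← hiter.lintegral_comp hG,
    lintegral_map (f := fun u => hitDrift 0 k 0 (extendEnv (shiftSeq^[a] u)))
      (hG.comp hiter.measurable) measurable_restrictNN]
  refine lintegral_congr_ae ?_
  filter_upwards [hcookie] with ω hω
  have h1 : hitDrift a (k + a) 0 ω = hitDrift a (k + a) a ω :=
    hitDrift_eq_of_eq (by omega) hω hω (fun _ _ => rfl) (by omega) le_rfl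
  have h2 := hitDrift_translate a 0 k 0 ω
  rw [zero_add] at h2
  rw [h1, ← h2]
  refine hitDrift_eq_of_eq hk (fun z i => hω _ _) (fun z i => ?_) (fun z hz => ?_) le_rfl le_rfl
  · rw [extendEnv, iterate_shiftSeq]
    exact hω _ _
  · rw [extendEnv, iterate_shiftSeq, restrictNN]
    push_cast
    rw [Int.toNat_of_nonneg hz]

lemma le_one_of_forall_nat_mul_le {v : ℝ≥0∞} {J : ℕ} (h : ∀ K : ℕ, K * v ≤ (J + K : ℕ)) :
    v ≤ 1 := by
  have hv : v ≠ ∞ := by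
    refine ne_top_of_le_ne_top (ENNReal.natCast_ne_top (J + 1)) ?_
    simpa using h 1
  lift v to NNReal using hv
  have h' (K : ℕ) : (K : ℝ) * v ≤ J + K := by exact_mod_cast h K
  by_contra! hcon
  have hcon' : (1 : ℝ) < v := by exact_mod_cast hcon
  obtain ⟨K, hK⟩ := exists_nat_gt (J / ((v : ℝ) - 1))
  rw [div_lt_iff₀ (by linarith)] at hK
  linarith [h' K]

lemma lintegral_hitDrift_le_one {Pr : Measure CEnv} [IsProbabilityMeasure Pr]
    (hcookie : ∀ᵐ ω ∂Pr, IsCookieEnv ω) (hstat : IsStationaryEnv Pr) (a : ℕ) {J : ℕ}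
    (hJ : 0 < J) :
    ∫⁻ ω, hitDrift a (J + a) 0 ω ∂Pr ≤ 1 := by
  refine le_one_of_forall_nat_mul_le (J := J) fun K => ?_
  have hle (b : ℕ) (hb : b ∈ Finset.range K) :
      ∫⁻ ω, hitDrift a (J + a) 0 ω ∂Pr ≤ ∫⁻ ω, hitDrift b (J + K : ℕ) 0 ω ∂Pr := by
    rw [Finset.mem_range] at hb
    rw [lintegral_hitDrift_eq hcookie hstat a (by omega),
      ← lintegral_hitDrift_eq hcookie hstat b (by omega)]
    exact lintegral_mono fun ω => hitDrift_mono_level (by push_cast; omega) 0 ω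
  calc (K : ℝ≥0∞) * ∫⁻ ω, hitDrift a (J + a) 0 ω ∂Pr
      ≤ ∑ b ∈ Finset.range K, ∫⁻ ω, hitDrift b (J + K : ℕ) 0 ω ∂Pr := by
        simpa using Finset.card_nsmul_le_sum _ _ _ hle
    _ = ∫⁻ ω, ∑ b ∈ Finset.range K, hitDrift b (J + K : ℕ) 0 ω ∂Pr :=
        (lintegral_finsetSum _ fun b _ => measurable_hitDrift _ _ _).symm
    _ ≤ ∫⁻ _, ((J + K : ℕ) : ℝ≥0∞) ∂Pr := by
        refine lintegral_mono_ae ?_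
        filter_upwards [hcookie] with ω hω
        have := sum_hitDrift_le ((Finset.range K).map Nat.castEmbedding)
          (k := (J + K : ℕ)) (y := 0) (by omega) hω
        rw [sub_zero, Int.cast_natCast, ENNReal.ofReal_natCast, Finset.sum_map] at this
        exact this
    _ = (J + K : ℕ) := by simp

/-- Lemma 14. If `(ω(x))_{x≥0}` is stationary under `Pr` then
`E_0[D_∞^x] ≤ 1` for every site `x ≥ 0`. -/
theorem erw_drift_at_site_le_one (Pr : Measure CEnv) [IsProbabilityMeasure Pr]
    (hcookie : ∀ᵐ ω ∂Pr, IsCookieEnv ω)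
    (hstat : IsStationaryEnv Pr)
    (κ : Kernel CEnv (ℕ → ℤ)) [IsMarkovKernel κ]
    (hκ : ∀ ω, IsCookieEnv ω → IsERWLaw ω 0 (κ ω))
    (x : ℤ) (hx : 0 ≤ x) :
    ∫⁻ p, driftAt p.1 p.2 x ⊤ ∂(Pr.compProd κ) ≤ 1 := by
  lift x to ℕ using hx
  have hmeas (N : ℕ) : Measurable fun p : CEnv × (ℕ → ℤ) =>
      ∑ n ∈ Finset.range N, driftStep x p.1 p.2 n :=
    Finset.measurable_sum _ fun n _ => measurable_driftStep x n
  have hmono : Monotone fun (N : ℕ) (p : CEnv × (ℕ → ℤ)) =>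
      ∑ n ∈ Finset.range N, driftStep x p.1 p.2 n := fun M N hMN p =>
    Finset.sum_le_sum_of_subset (Finset.range_mono hMN)
  have hbound (N : ℕ) : ∀ᵐ ω ∂Pr,
      ∫⁻ Y, ∑ n ∈ Finset.range N, driftStep x ω Y n ∂(κ ω)
        ≤ hitDrift x ((N + 1 : ℕ) + x) 0 ω := by
    filter_upwards [hcookie] with ω hω
    have h := (hκ ω hω).isScaledERWLaw.lintegral_driftStep_le hω x (N := N)
      (k := (N + 1 : ℕ) + x) (by push_cast; omega)
    rw [one_mul] at h
    exact h.trans (stoppedDrift_le_hitDrift _ _ _ _ _)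
  calc ∫⁻ p, driftAt p.1 p.2 x ⊤ ∂(Pr.compProd κ)
      ≤ ∫⁻ p, ⨆ N, ∑ n ∈ Finset.range N, driftStep x p.1 p.2 n ∂(Pr.compProd κ) :=
        lintegral_mono fun p => driftAt_top_le x p.1 p.2
    _ = ⨆ N, ∫⁻ p, ∑ n ∈ Finset.range N, driftStep x p.1 p.2 n ∂(Pr.compProd κ) :=
        lintegral_iSup hmeas hmono
    _ ≤ 1 := iSup_le fun N => by
        rw [Measure.lintegral_compProd (hmeas N)]
        exact (lintegral_mono_ae (hbound N)).trans
          (lintegral_hitDrift_le_one hcookie hstat x N.succ_pos)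

end
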